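/- arXiv:2510.18359 — 2 statements merged into one kernel-verified Lean document; each statement's English description precedes it below -/
import Mathlib

section
/- Let G be a connected 4-regular simple graph with at least one vertex. Then the subdivided double D(G) has a Hamiltonian cycle, and for every Hamiltonian cycle H of D(G), the complement of H in D(G) (the spanning subgraph of D(G) whose edge set is E(D(G)) \ E(H)) is also a Hamiltonian cycle of D(G). In other words, D(G) is Hamiltonian-paired. -/
open SimpleGraph

/-- The subdivided double `D(G)` of a simple graph `G`: vertices are the twin vertices
`(v, i)` for `v : V`, `i : Bool`, together with the subdivision vertices (edges of `G`);
a twin vertex `(v, i)` is adjacent to a subdivision vertex `e` iff `v` is an endpoint of `e`. -/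
def subdividedDouble {V : Type*} (G : SimpleGraph V) :
    SimpleGraph ((V × Bool) ⊕ ↥G.edgeSet) :=
  SimpleGraph.fromRel fun x y =>
    ∃ (v : V) (i : Bool) (e : G.edgeSet),
      x = Sum.inl (v, i) ∧ y = Sum.inr e ∧ v ∈ (e : Sym2 V)

/-- A 4-regular graph is Hamiltonian-paired if it is Hamiltonian and the complement of
every Hamiltonian cycle (the spanning subgraph on the unused edges) is again a
Hamiltonian cycle. -/
def HamiltonianPaired {W : Type*} [DecidableEq W] (X : SimpleGraph W) : Prop :=
  (∃ (x : W) (H : X.Walk x x), H.IsHamiltonianCycle) ∧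
    ∀ (x : W) (H : X.Walk x x), H.IsHamiltonianCycle →
      ∃ (y : W) (H' : X.Walk y y), H'.IsHamiltonianCycle ∧
        ∀ e, e ∈ H'.edges ↔ e ∈ X.edgeSet ∧ e ∉ H.edges

namespace SimpleGraph

section Eulerian

variable {V : Type*} {G : SimpleGraph V}

theorem Walk.IsTrail.mem_edges_of_forall_length_le {u v w : V} {p : G.Walk u v} (hp : p.IsTrail)
    (hmax : ∀ (a b : V) (q : G.Walk a b), q.IsTrail → q.length ≤ p.length) (h : G.Adj u w) :
    s(u, w) ∈ p.edges := by
  by_contra hmem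
  have := hmax _ _ (.cons h.symm p) (by simp [hp, Sym2.eq_swap, hmem])
  simp at this

theorem Walk.countP_mem_edges_add [DecidableEq V] {u v : V} (p : G.Walk u v) (x : V) :
    (p.edges.countP fun e => x ∈ e) + (if x = u then 1 else 0) + (if x = v then 1 else 0) =
      2 * p.support.count x := by
  induction p with
  | nil => simp only [edges_nil, List.countP_nil, support_nil, List.count_cons]; grind
  | @cons a b c h p ih =>
    have := h.ne
    simp only [edges_cons, List.countP_cons, support_cons, List.count_cons, Sym2.mem_iff,
      decide_eq_true_eq, beq_iff_eq]
    grind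

variable [Fintype V] [DecidableEq V] [DecidableRel G.Adj]

theorem Walk.IsTrail.countP_mem_edges_eq_degree {u v x : V} {p : G.Walk u v} (hp : p.IsTrail)
    (hx : ∀ w, G.Adj x w → s(x, w) ∈ p.edges) :
    (p.edges.countP fun e => x ∈ e) = G.degree x := by
  rw [List.countP_eq_length_filter, ← List.toFinset_card_of_nodup (hp.edges_nodup.filter _),
    ← card_incidenceFinset_eq_degree]
  congr 1
  ext e
  induction e with | _ a b
  simp only [List.mem_toFinset, List.mem_filter, decide_eq_true_eq, mem_incidenceFinset,
    mk'_mem_incidenceSet_iff, Sym2.mem_iff]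
  refine ⟨fun ⟨h, h'⟩ => ⟨p.adj_of_mem_edges h, h'⟩, fun ⟨h, h'⟩ => ⟨?_, h'⟩⟩
  rcases h' with rfl | rfl
  · exact hx _ h
  · rw [Sym2.eq_swap]
    exact hx _ h.symm

theorem Connected.exists_isEulerian (hconn : G.Connected) (heven : ∀ v, Even (G.degree v)) :
    ∃ (u : V) (p : G.Walk u u), p.IsEulerian := by
  obtain ⟨u, v, p, hp, hmax⟩ : ∃ (u v : V) (p : G.Walk u v), p.IsTrail ∧
      ∀ (a b : V) (q : G.Walk a b), q.IsTrail → q.length ≤ p.length := by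
    let S : Set ℕ := {n | ∃ (u v : V) (p : G.Walk u v), p.IsTrail ∧ p.length = n}
    have hS : S.Nonempty := ⟨0, hconn.nonempty.some, _, .nil, by simp⟩
    have hb : BddAbove S := by
      refine ⟨G.edgeFinset.card, ?_⟩
      rintro _ ⟨u, v, p, hp, rfl⟩
      exact hp.length_le_card_edgeFinset
    obtain ⟨u, v, p, hp, hl⟩ := Nat.sSup_mem hS hb
    exact ⟨u, v, p, hp, fun a b q hq => hl ▸ le_csSup hb ⟨a, b, q, hq, rfl⟩⟩
  obtain rfl : u = v := by
    by_contra hne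
    have h := (hp.even_countP_edges_iff u).1 (by
      rw [hp.countP_mem_edges_eq_degree fun w => hp.mem_edges_of_forall_length_le hmax]
      exact heven u) hne
    exact h.1 rfl
  have hused : ∀ x ∈ p.support, ∀ w, G.Adj x w → s(x, w) ∈ p.edges := by
    intro x hx w hw
    have h := (hp.rotate hx).mem_edges_of_forall_length_le (by simpa using hmax) hw
    exact (p.rotate_edges x hx).mem_iff.1 h
  have hall : ∀ x, x ∈ p.support := by
    intro x
    obtain ⟨q⟩ := hconn.preconnected u x
    induction q using Walk.concatRec with
    | Hnil => simp
    | Hconcat q h ih => exact p.snd_mem_support_of_mem_edges (hused _ (ih p hp hmax hused) _ h)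
  refine ⟨u, p, hp.isEulerian_of_forall_mem fun e he => ?_⟩
  induction e with | _ a b
  exact hused a (hall a) b he

end Eulerian

end SimpleGraph

section Lift

variable {V : Type*} {G : SimpleGraph V}

@[simp]
theorem subdividedDouble_adj_inl_inr {v : V} {i : Bool} {e : G.edgeSet} :
    (subdividedDouble G).Adj (.inl (v, i)) (.inr e) ↔ v ∈ (e : Sym2 V) := by
  cases i <;> simp [subdividedDouble]

@[simp]
theorem subdividedDouble_adj_inr_inl {v : V} {i : Bool} {e : G.edgeSet} :
    (subdividedDouble G).Adj (.inr e) (.inl (v, i)) ↔ v ∈ (e : Sym2 V) := by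
  cases i <;> simp [subdividedDouble]

@[simp]
theorem not_subdividedDouble_adj_inl_inl {x y : V × Bool} :
    ¬ (subdividedDouble G).Adj (.inl x) (.inl y) := by
  simp [subdividedDouble]

@[simp]
theorem not_subdividedDouble_adj_inr_inr {e f : G.edgeSet} :
    ¬ (subdividedDouble G).Adj (.inr e) (.inr f) := by
  simp [subdividedDouble]

variable [DecidableEq V]

/-- The lift of a walk to the subdivided double in which the copies of each vertex alternate,
the last visit to each vertex being to the copy labelled `false`. -/
def SimpleGraph.Walk.liftDouble : {u v : V} → (p : G.Walk u v) →
    (subdividedDouble G).Walk (.inl (u, decide (Odd (p.support.tail.count u)))) (.inl (v, false))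
  | _, _, .nil => Walk.nil.copy (by simp) rfl
  | u, _, .cons (v := w) h p =>
    .cons (v := .inr ⟨s(u, w), h⟩) (by simp) <|
      .cons (v := .inl (w, decide (Odd (p.support.tail.count w)))) (by simp) p.liftDouble

theorem SimpleGraph.Walk.support_liftDouble_nil (u : V) :
    (Walk.nil : G.Walk u u).liftDouble.support = [.inl (u, false)] :=
  Walk.support_copy _ _ _

theorem SimpleGraph.Walk.support_liftDouble_cons {u v w : V} (h : G.Adj u v) (p : G.Walk v w) :
    (Walk.cons h p).liftDouble.support =
      .inl (u, decide (Odd (p.support.count u))) :: .inr ⟨s(u, v), h⟩ :: p.liftDouble.support :=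
  rfl

theorem SimpleGraph.Walk.countP_support_liftDouble_eq_inl {u v : V} (p : G.Walk u v) (x : V)
    (i : Bool) :
    (p.liftDouble.support.countP fun y => y = .inl (x, i)) =
      (p.support.count x + (!i).toNat) / 2 := by
  induction p with
  | @nil a =>
    rw [support_liftDouble_nil]
    by_cases hax : a = x <;> cases i <;> simp [hax]
  | @cons a b c h p ih =>
    rw [support_liftDouble_cons, List.countP_cons, List.countP_cons, ih, support_cons,
      List.count_cons]
    by_cases hax : a = x
    · subst hax
      cases i <;> by_cases ho : Odd (p.support.count a) <;> simp [ho] <;> grind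
    · simp [hax]

theorem SimpleGraph.Walk.countP_support_liftDouble_eq_inr {u v : V} (p : G.Walk u v)
    (e : G.edgeSet) :
    (p.liftDouble.support.countP fun y => y = .inr e) = p.edges.count (e : Sym2 V) := by
  induction p with
  | nil => rw [support_liftDouble_nil]; simp
  | cons h p ih =>
    rw [support_liftDouble_cons, List.countP_cons, List.countP_cons, ih, edges_cons,
      List.count_cons]
    simp [Subtype.ext_iff]

end Lift

theorem exists_isHamiltonianCycle_subdividedDouble {V : Type*} [Fintype V] [DecidableEq V]
    {G : SimpleGraph V} [DecidableRel G.Adj] (hconn : G.Connected)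
    (hreg : G.IsRegularOfDegree 4) :
    ∃ (x : _) (H : (subdividedDouble G).Walk x x), H.IsHamiltonianCycle := by
  obtain ⟨u, p, hp⟩ := hconn.exists_isEulerian fun v => by rw [hreg v]; decide
  have hcount (x : V) : p.support.count x = if x = u then 3 else 2 := by
    have h := p.countP_mem_edges_add x
    rw [hp.isTrail.countP_mem_edges_eq_degree fun w hw => hp.mem_edges_iff.2 hw, hreg x] at h
    grind
  have hlab : decide (Odd (p.support.tail.count u)) = false := by
    have h := hcount u
    rw [← Walk.cons_tail_support, List.count_cons_self, if_pos rfl] at h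
    rw [Nat.succ.inj h]
    decide
  let H : (subdividedDouble G).Walk (.inl (u, false)) (.inl (u, false)) :=
    p.liftDouble.copy (by rw [hlab]) rfl
  have htail : ∀ x, (H.support.tail.countP fun y => y = x) = 1 := by
    intro x
    have h : (p.liftDouble.support.countP fun y => y = x) = (H.support.tail.countP fun y => y = x) +
        if decide (.inl (u, false) = x) then 1 else 0 := by
      rw [← List.countP_cons, Walk.cons_tail_support, Walk.support_copy]
    rcases x with ⟨x, i⟩ | e
    · rw [Walk.countP_support_liftDouble_eq_inl, hcount] at h
      by_cases hx : x = u
      · subst hx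
        cases i <;> simpa using h.symm
      · have hx' : u ≠ x := Ne.symm hx
        cases i <;> simpa [hx, hx'] using h.symm
    · rw [Walk.countP_support_liftDouble_eq_inr, hp _ e.2] at h
      simpa using h.symm
  have hmem (x) : x ∈ H.support.tail := by
    have h := htail x
    by_contra hx
    rw [List.countP_eq_zero.2] at h
    · exact absurd h (by decide)
    · rintro y hy hyx
      simp only [decide_eq_true_eq] at hyx
      exact hx (hyx ▸ hy)
  have hlen : 3 ≤ H.length := by
    obtain ⟨w, hw⟩ : ∃ w, G.Adj u w := by
      rw [← G.degree_pos_iff_exists_adj, hreg u]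
      decide
    have h := (Finset.card_le_card (s := {.inl (u, false), .inl (u, true), .inr ⟨s(u, w), hw⟩})
      fun x _ => List.mem_toFinset.2 (hmem x)).trans (List.toFinset_card_le _)
    simpa using h
  have hnil : ¬ H.Nil := fun h => by
    rw [Walk.length_eq_zero_iff.2 h] at hlen
    exact absurd hlen (by decide)
  refine ⟨_, H, Walk.isHamiltonianCycle_iff_isCycle_and_support_count_tail_eq_one.2 ⟨?_, htail⟩⟩
  rw [Walk.isCycle_iff_isPath_tail_and_le_length]
  refine ⟨Walk.IsPath.mk' ?_, hlen⟩
  rw [Walk.support_tail_of_not_nil _ hnil]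
  exact (@List.nodup_iff_count_le_one _ instBEqOfDecidableEq _ _).2 fun x => (htail x).le

section Complement

variable {V : Type*} [Fintype V] [DecidableEq V] {G : SimpleGraph V} [DecidableRel G.Adj]

/-- The edges of `G` incident to `v`, as subdivision vertices. -/
def incidentEdges (G : SimpleGraph V) [DecidableRel G.Adj] (v : V) : Finset G.edgeSet :=
  {e | v ∈ (e : Sym2 V)}

@[simp]
theorem mem_incidentEdges {v : V} {e : G.edgeSet} :
    e ∈ incidentEdges G v ↔ v ∈ (e : Sym2 V) := by
  simp [incidentEdges]

theorem card_incidentEdges (v : V) : (incidentEdges G v).card = G.degree v := by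
  rw [← card_incidenceFinset_eq_degree, ← Finset.card_map (Function.Embedding.subtype _)]
  congr 1
  ext e
  simp [mem_incidenceFinset, incidenceSet, and_comm]

theorem eq_of_forall_mem_of_card_eq_two {α : Type*} [DecidableEq α] {A : V → Bool → Finset α}
    {e : α} (hdeg : (Finset.univ.filter fun x : V × Bool => e ∈ A x.1 x.2).card = 2) {v w : V}
    {i : Bool} (hv : ∀ j, e ∈ A v j) (hw : e ∈ A w i) : w = v := by
  by_contra hwv
  have h := Finset.card_le_card (s := {(v, false), (v, true), (w, i)})
    (t := Finset.univ.filter fun x : V × Bool => e ∈ A x.1 x.2) (by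
      intro x hx
      simp only [Finset.mem_insert, Finset.mem_singleton] at hx
      rcases hx with rfl | rfl | rfl <;> simp [hv, hw])
  rw [hdeg, Finset.card_eq_three.2 ⟨_, _, _, by simp, by simp [Ne.symm hwv],
    by simp [Ne.symm hwv], rfl⟩] at h
  exact absurd h (by decide)

/-- If each subdivision vertex is chosen by two twin vertices and each twin vertex chooses two of
its four neighbours, twins choosing different pairs, then there is a permutation of the
subdivision vertices carrying the choice of each twin vertex into the complement of the choice of
the other twin. -/
theorem exists_injective_mapsTo_compl (hreg : G.IsRegularOfDegree 4)
    (A : V → Bool → Finset G.edgeSet) (hinc : ∀ v i, A v i ⊆ incidentEdges G v)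
    (hcard : ∀ v i, (A v i).card = 2) (hne : ∀ v, A v false ≠ A v true)
    (hdeg : ∀ e, (Finset.univ.filter fun x : V × Bool => e ∈ A x.1 x.2).card = 2) :
    ∃ σ : G.edgeSet → G.edgeSet, Function.Injective σ ∧
      ∀ v i, ∀ e ∈ A v i, σ e ∈ incidentEdges G v \ A v (!i) := by
  classical
  have hsum (v : V) : (A v false ∩ A v true).card =
      (incidentEdges G v \ (A v false ∪ A v true)).card := by
    have h₁ := Finset.card_union_add_card_inter (A v false) (A v true)
    have h₂ := Finset.card_sdiff_add_card_eq_card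
      (Finset.union_subset (hinc v false) (hinc v true))
    rw [card_incidentEdges, hreg v] at h₂
    rw [hcard, hcard] at h₁
    lia
  have hinter (v : V) : (A v false ∩ A v true).card ≤ 1 := by
    by_contra! h
    have h₁ := Finset.eq_of_subset_of_card_le (Finset.inter_subset_left (s₂ := A v true))
      ((hcard v false).trans_le h)
    have h₂ := Finset.eq_of_subset_of_card_le (Finset.inter_subset_right (s₁ := A v false))
      ((hcard v true).trans_le h)
    exact hne v (h₁.symm.trans h₂)
  have hfull {e : G.edgeSet} {v w : V} {i : Bool} (hv : ∀ j, e ∈ A v j) (hw : e ∈ A w i) :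
      w = v := eq_of_forall_mem_of_card_eq_two (hdeg e) hv hw
  have hfree {e : G.edgeSet} {v : V} (hv : v ∈ (e : Sym2 V)) (hn : ∀ i, e ∉ A v i) :
      ∃ w, ∀ j, e ∈ A w j := by
    obtain ⟨⟨w, i⟩, ⟨w', j⟩, hij, h⟩ := Finset.card_eq_two.1 (hdeg e)
    have hw : e ∈ A w i := by
      have : (w, i) ∈ ({(w, i), (w', j)} : Finset (V × Bool)) := by simp
      simpa [← h] using this
    have hw' : e ∈ A w' j := by
      have : (w', j) ∈ ({(w, i), (w', j)} : Finset (V × Bool)) := by simp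
      simpa [← h] using this
    obtain ⟨u, hu⟩ := Sym2.mem_iff_exists.1 hv
    have key {x k} (hx : e ∈ A x k) : x = u := by
      have hm := mem_incidentEdges.1 (hinc x k hx)
      rw [hu, Sym2.mem_iff] at hm
      exact hm.resolve_left fun h => hn k (h ▸ hx)
    obtain rfl := key hw
    obtain rfl := key hw'
    have : i ≠ j := fun h => hij (h ▸ rfl)
    refine ⟨w', fun k => ?_⟩
    rcases Bool.eq_or_eq_not k i with rfl | rfl
    · exact hw
    · rwa [← Bool.eq_not.2 this.symm]
  have hd (e : G.edgeSet) : ∃ f : G.edgeSet, ∀ v, (∀ j, e ∈ A v j) →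
      v ∈ (f : Sym2 V) ∧ ∀ j, f ∉ A v j := by
    by_cases h : ∃ v, ∀ j, e ∈ A v j
    · obtain ⟨v, hv⟩ := h
      have hpos : 0 < (incidentEdges G v \ (A v false ∪ A v true)).card := by
        rw [← hsum, Finset.card_pos]
        exact ⟨e, by simp [hv]⟩
      obtain ⟨f, hf⟩ := Finset.card_pos.1 hpos
      simp only [Finset.mem_sdiff, mem_incidentEdges, Finset.mem_union, not_or] at hf
      refine ⟨f, fun w hw => ?_⟩
      obtain rfl := hfull hv (hw true)
      exact ⟨hf.1, fun j => by cases j <;> simp [hf]⟩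
    · exact ⟨e, fun v hv => (h ⟨v, hv⟩).elim⟩
  choose d hd using hd
  refine ⟨fun e => if ∃ v, ∀ j, e ∈ A v j then d e else e, ?_, ?_⟩
  · intro e f hef
    dsimp only at hef
    split_ifs at hef with he hf hf
    · obtain ⟨v, hv⟩ := he
      obtain ⟨w, hw⟩ := hf
      have h₁ := hd e v hv
      have h₂ := hd f w hw
      rw [← hef] at h₂
      obtain rfl : v = w := by
        by_contra hvw
        obtain ⟨x, hx⟩ := hfree h₁.1 h₁.2
        have hm := mem_incidentEdges.1 (hinc x true (hx true))
        rw [(Sym2.mem_and_mem_iff hvw).1 ⟨h₁.1, h₂.1⟩, Sym2.mem_iff] at hm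
        rcases hm with rfl | rfl
        · exact h₁.2 true (hx true)
        · exact h₂.2 true (hx true)
      exact Finset.card_le_one.1 (hinter v) e (by simp [hv]) f (by simp [hw])
    · obtain ⟨v, hv⟩ := he
      exact (hf (hef ▸ hfree (hd e v hv).1 (hd e v hv).2)).elim
    · obtain ⟨v, hv⟩ := hf
      exact (he (hef ▸ hfree (hd f v hv).1 (hd f v hv).2)).elim
    · exact hef
  · intro v i e he
    simp only [Finset.mem_sdiff, mem_incidentEdges]
    split_ifs with h
    · obtain ⟨w, hw⟩ := h
      obtain rfl := hfull hw he
      exact ⟨(hd e v hw).1, (hd e v hw).2 _⟩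
    · refine ⟨mem_incidentEdges.1 (hinc v i he), fun h' => h ⟨v, fun j => ?_⟩⟩
      rcases Bool.eq_or_eq_not j i with rfl | rfl
      · exact he
      · exact h'

theorem SimpleGraph.Walk.IsHamiltonianCycle.exists_complement_subdividedDouble
    (hreg : G.IsRegularOfDegree 4) {x : (V × Bool) ⊕ G.edgeSet}
    {H : (subdividedDouble G).Walk x x} (hH : H.IsHamiltonianCycle) :
    ∃ (y : _) (H' : (subdividedDouble G).Walk y y), H'.IsHamiltonianCycle ∧
      ∀ e, e ∈ H'.edges ↔ e ∈ (subdividedDouble G).edgeSet ∧ e ∉ H.edges := by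
  let A (v : V) (i : Bool) : Finset G.edgeSet := {e | s(.inl (v, i), .inr e) ∈ H.edges}
  have memA {v i e} : e ∈ A v i ↔ s(.inl (v, i), .inr e) ∈ H.edges := by simp [A]
  have hinc (v i) : A v i ⊆ incidentEdges G v := fun e he => by
    simpa using H.adj_of_mem_edges (memA.1 he)
  have hdeg (y) := hH.isCycle.ncard_neighborSet_toSubgraph_eq_two (hH.mem_support y)
  have hcard (v i) : (A v i).card = 2 := by
    rw [← hdeg (.inl (v, i)), ← Set.ncard_coe_finset,
      ← Set.ncard_image_of_injective _ (Sum.inr_injective (α := V × Bool))]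
    congr 1
    ext (y | e)
    · simp [Subgraph.mem_neighborSet, Walk.adj_toSubgraph_iff_mem_edges]
      exact fun h => not_subdividedDouble_adj_inl_inl (H.adj_of_mem_edges h)
    · simp [Subgraph.mem_neighborSet, Walk.adj_toSubgraph_iff_mem_edges, memA]
  have hdegE (e) : (Finset.univ.filter fun x : V × Bool => e ∈ A x.1 x.2).card = 2 := by
    rw [← hdeg (.inr e), ← Set.ncard_coe_finset,
      ← Set.ncard_image_of_injective _ (Sum.inl_injective (β := G.edgeSet))]
    congr 1
    ext (y | f)
    · simp [Subgraph.mem_neighborSet, Walk.adj_toSubgraph_iff_mem_edges, memA, Sym2.eq_swap]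
    · simp [Subgraph.mem_neighborSet, Walk.adj_toSubgraph_iff_mem_edges]
      exact fun h => not_subdividedDouble_adj_inr_inr (H.adj_of_mem_edges h)
  have hne (v) : A v false ≠ A v true := by
    intro hv
    let S : Set ((V × Bool) ⊕ G.edgeSet) :=
      {y | Sum.elim (fun z => z.1 = v) (fun e => e ∈ A v false) y}
    have hall {e} (he : e ∈ A v false) (j) : e ∈ A v j := by
      cases j
      · exact he
      · exact hv ▸ he
    have hS {y z} (h : s(y, z) ∈ H.edges) (hy : y ∈ S) : z ∈ S := by
      rcases y with ⟨w, i⟩ | e <;> rcases z with ⟨w', j⟩ | e'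
      · exact (not_subdividedDouble_adj_inl_inl (H.adj_of_mem_edges h)).elim
      · obtain rfl : w = v := hy
        have := memA.2 h
        cases i
        · exact this
        · exact (Finset.ext_iff.1 hv _).2 this
      · rw [Sym2.eq_swap] at h
        exact eq_of_forall_mem_of_card_eq_two (hdegE e) (hall hy) (memA.2 h)
      · exact (not_subdividedDouble_adj_inr_inr (H.adj_of_mem_edges h)).elim
    obtain ⟨e, he⟩ : (incidentEdges G v \ A v false).Nonempty := by
      rw [← Finset.card_pos, Finset.card_sdiff_of_subset (hinc v false), card_incidentEdges,
        hreg v, hcard]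
      decide
    have hmem := hH.mem_support (.inl (v, false))
    have hmem' : .inr e ∈ (H.rotate _ hmem).support := (hH.rotate hmem).mem_support _
    obtain ⟨d, hd, hd₁, hd₂⟩ := ((H.rotate _ hmem).takeUntil _ hmem').exists_boundary_dart S rfl
      (Finset.mem_sdiff.1 he).2
    have hde := (H.rotate _ hmem).edges_takeUntil_subset_edges hmem' (List.mem_map_of_mem hd)
    exact hd₂ (hS ((H.rotate_edges _ hmem).mem_iff.1 hde) hd₁)
  obtain ⟨σ, hσ, hmaps⟩ := exists_injective_mapsTo_compl hreg A hinc hcard hne hdegE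
  have himage (v i) : (A v (!i)).image σ = incidentEdges G v \ A v i := by
    apply Finset.eq_of_subset_of_card_le
    · intro f hf
      obtain ⟨e, he, rfl⟩ := Finset.mem_image.1 hf
      simpa using hmaps v (!i) e he
    · rw [Finset.card_image_of_injective _ hσ, hcard, Finset.card_sdiff_of_subset (hinc v i),
        card_incidentEdges, hreg v, hcard]
  let φ : (V × Bool) ⊕ G.edgeSet → (V × Bool) ⊕ G.edgeSet := Sum.map (fun z => (z.1, !z.2)) σ
  have hφ : Function.Bijective φ := by
    rw [← Finite.injective_iff_bijective]
    refine Function.Injective.sumMap (fun a b h => ?_) hσ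
    simpa [Prod.ext_iff] using h
  let X : SimpleGraph ((V × Bool) ⊕ G.edgeSet) := H.toSubgraph.spanningCoe
  have hX {y z} : X.Adj y z ↔ s(y, z) ∈ H.edges := by
    simp [X, Walk.adj_toSubgraph_iff_mem_edges]
  have hXφ {v i e} (h : s(.inl (v, i), .inr e) ∈ H.edges) :
      (subdividedDouble G).Adj (φ (.inl (v, i))) (φ (.inr e)) := by
    have := hmaps v i e (memA.2 h)
    simp only [Finset.mem_sdiff, mem_incidentEdges] at this
    simpa [φ] using this.1
  let f : X →g subdividedDouble G := ⟨φ, by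
    rintro (⟨v, i⟩ | e) (⟨w, j⟩ | e') h
    · exact (not_subdividedDouble_adj_inl_inl (H.adj_of_mem_edges (hX.1 h))).elim
    · exact hXφ (hX.1 h)
    · exact (hXφ (hX.1 h.symm)).symm
    · exact (not_subdividedDouble_adj_inr_inr (H.adj_of_mem_edges (hX.1 h))).elim⟩
  let K : X.Walk x x := H.transfer X fun e he => by
    induction e with | _ a b
    exact hX.2 he
  have hK : K.IsHamiltonianCycle := by
    rw [Walk.isHamiltonianCycle_iff_isCycle_and_support_count_tail_eq_one] at hH ⊢
    exact ⟨hH.1.transfer _, by simpa [K] using hH.2⟩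
  have hKe : K.edges = H.edges := by simp [K]
  have key (v i e) : s(.inl (v, i), .inr e) ∈ (K.map f).edges ↔
      e ∈ incidentEdges G v \ A v i := by
    rw [← himage, Walk.edges_map, hKe, List.mem_map, Finset.mem_image]
    constructor
    · rintro ⟨a, ha, hae⟩
      induction a with | _ a b
      rcases a with ⟨w, j⟩ | a <;> rcases b with ⟨w', j'⟩ | b
      · simp [f, φ] at hae
      · obtain ⟨⟨rfl, rfl⟩, rfl⟩ : (w = v ∧ (!j) = i) ∧ σ b = e := by simpa [f, φ] using hae
        exact ⟨b, by simpa [memA] using ha, rfl⟩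
      · obtain ⟨rfl, rfl, rfl⟩ : σ a = e ∧ w' = v ∧ (!j') = i := by simpa [f, φ] using hae
        rw [Sym2.eq_swap] at ha
        exact ⟨a, by simpa [memA] using ha, rfl⟩
      · simp [f, φ] at hae
    · rintro ⟨e', he', rfl⟩
      exact ⟨_, memA.1 he', by simp [f, φ]⟩
  refine ⟨_, K.map f, hK.map hφ, fun e => ?_⟩
  have key' (v i e) : s(.inl (v, i), .inr e) ∈ (K.map f).edges ↔
      s(.inl (v, i), .inr e) ∈ (subdividedDouble G).edgeSet ∧ s(.inl (v, i), .inr e) ∉ H.edges := by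
    rw [key, Finset.mem_sdiff, memA, mem_incidentEdges, SimpleGraph.mem_edgeSet,
      subdividedDouble_adj_inl_inr]
  induction e with | _ a b
  rcases a with ⟨v, i⟩ | e <;> rcases b with ⟨w, j⟩ | e'
  · refine iff_of_false (fun h => ?_) fun h => not_subdividedDouble_adj_inl_inl h.1
    exact not_subdividedDouble_adj_inl_inl ((K.map f).adj_of_mem_edges h)
  · exact key' _ _ _
  · rw [Sym2.eq_swap]
    exact key' _ _ _
  · refine iff_of_false (fun h => ?_) fun h => not_subdividedDouble_adj_inr_inr h.1
    exact not_subdividedDouble_adj_inr_inr ((K.map f).adj_of_mem_edges h)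

end Complement

theorem subdividedDouble_hamiltonianPaired {V : Type} [Fintype V] [DecidableEq V] [Nonempty V]
    (G : SimpleGraph V) [DecidableRel G.Adj]
    (hconn : G.Connected) (hreg : G.IsRegularOfDegree 4) :
    HamiltonianPaired (subdividedDouble G) := by
  exact ⟨exists_isHamiltonianCycle_subdividedDouble hconn hreg, fun _ _ hH =>
    hH.exists_complement_subdividedDouble hreg⟩
end

section
/- For every integer n ≥ 2, the circulant graph C_{4n}^{1,2n−1} — the simple graph on the vertex set Z/(4n) in which i and j are adjacent if and only if i − j ≡ ±1 or ±(2n−1) (mod 4n) — is Hamiltonian-paired: it is Hamiltonian, and the complement of every Hamiltonian cycle (the spanning subgraph on the edges not used by that Hamiltonian cycle) is again a Hamiltonian cycle. -/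
open SimpleGraph

section Layers

variable {A : Type*} [CommRing A] {d : A} {h : A → A → ℕ}

/-- `w` lies in the layer `{v + 1, v + 1 + d}` following the layer `{v, v + d}` of `v`. -/
def LayerStep (d v w : A) : Prop := w = v + 1 ∨ w = v + 1 + d

/-- The number of edges from `v` to the following layer, where `h` is the indicator function of
the edge set. -/
def forwardDegree (d : A) (h : A → A → ℕ) (v : A) : ℕ := h v (v + 1) + h v (v + 1 + d)

/-- `h` is the indicator function of the edges of a spanning 2-regular subgraph of the graph
in which consecutive layers `{v, v + d}` and `{v + 1, v + 1 + d}` are completely joined. -/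
structure IsTwoFactor (d : A) (h : A → A → ℕ) : Prop where
  add_self : d + d = 0
  symm : ∀ v w, h v w = h w v
  le_one : ∀ v w, h v w ≤ 1
  degree : ∀ v, forwardDegree d h (v + 1) + h v (v + 1) + h (v + d) (v + 1) = 2

namespace IsTwoFactor

lemma add_cancel (hf : IsTwoFactor d h) (v : A) : v + d + d = v := by
  rw [add_assoc, hf.add_self, add_zero]

lemma step_add_left (hf : IsTwoFactor d h) {v w : A} (hs : LayerStep d v w) :
    LayerStep d (v + d) w := by
  rcases hs with rfl | rfl
  · right; linear_combination -hf.add_self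
  · left; ring

lemma step_add_right (hf : IsTwoFactor d h) {v w : A} (hs : LayerStep d v w) :
    LayerStep d v (w + d) := by
  rcases hs with rfl | rfl
  · right; rfl
  · left; exact hf.add_cancel _

lemma step_add_left_iff (hf : IsTwoFactor d h) {v w : A} :
    LayerStep d (v + d) w ↔ LayerStep d v w :=
  ⟨fun hs ↦ hf.add_cancel v ▸ hf.step_add_left hs, hf.step_add_left⟩

lemma step_add_right_iff (hf : IsTwoFactor d h) {v w : A} :
    LayerStep d v (w + d) ↔ LayerStep d v w :=
  ⟨fun hs ↦ hf.add_cancel w ▸ hf.step_add_right hs, hf.step_add_right⟩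

lemma forwardDegree_eq (hf : IsTwoFactor d h) {v w : A} (hs : LayerStep d v w) :
    forwardDegree d h v = h v w + h v (w + d) := by
  rcases hs with rfl | rfl
  · rfl
  · rw [hf.add_cancel, add_comm]; rfl

lemma degree_eq (hf : IsTwoFactor d h) {v w : A} (hs : LayerStep d v w) :
    forwardDegree d h w + h v w + h (v + d) w = 2 := by
  rcases hs with rfl | rfl
  · exact hf.degree v
  · have := hf.degree (v + d)
    rw [hf.add_cancel, show v + d + 1 = v + 1 + d by ring] at this
    omega

lemma layer_sum (hf : IsTwoFactor d h) (v : A) :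
    forwardDegree d h v + forwardDegree d h (v + d) +
      (forwardDegree d h (v + 1) + forwardDegree d h (v + 1 + d)) = 4 := by
  have hs : LayerStep d v (v + 1) := Or.inl rfl
  have h₁ := hf.forwardDegree_eq hs
  have h₂ := hf.forwardDegree_eq (hf.step_add_left hs)
  have h₃ := hf.degree_eq hs
  have h₄ := hf.degree_eq (hf.step_add_right hs)
  omega

/-- Swapping the two vertices in every other layer complements a 2-factor all of whose vertices
in the remaining layers have one edge forward and one backward. -/
lemma exists_swap (hf : IsTwoFactor d h) (T : A → Prop) (hT₁ : ∀ v, T (v + 1) ↔ ¬ T v)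
    (hTd : ∀ v, T (v + d) ↔ T v) (hT : ∀ v, ¬ T v → forwardDegree d h v = 1) :
    ∃ (φ : A → A) (c : A), (∀ v, φ (v + d) = φ v + d) ∧ (∀ v, φ v = v + c ∨ φ v = v + c + d) ∧
      ∀ v w, LayerStep d v w → h (φ v) (φ w) + h v w = 1 := by
  classical
  refine ⟨fun v ↦ if T v then v + d else v, 0, fun v ↦ ?_, fun v ↦ ?_, fun v w hs ↦ ?_⟩
  · simp only [hTd]; split_ifs <;> rfl
  · simp only [add_zero]; split_ifs <;> simp
  · have hw : T w ↔ ¬ T v := by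
      rcases hs with rfl | rfl
      · exact hT₁ v
      · rw [hTd, hT₁]
    have h₁ := hf.forwardDegree_eq hs
    have h₂ := hf.degree_eq hs
    by_cases hv : T v
    · have := hT w (by tauto)
      simp only [hv, hw, if_true, not_true, if_false]
      omega
    · have := hT v hv
      simp only [hv, hw, if_true, not_false_iff, if_false]
      omega

/-- A 2-factor with an odd number of edges between any two consecutive layers is mapped to its
complement by an automorphism shifting the layers by one. -/
lemma exists_shift (hf : IsTwoFactor d h)
    (hodd : ∀ v, forwardDegree d h v + forwardDegree d h (v + d) = 1 ∨
      forwardDegree d h v + forwardDegree d h (v + d) = 3) :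
    ∃ (φ : A → A) (c : A), (∀ v, φ (v + d) = φ v + d) ∧ (∀ v, φ v = v + c ∨ φ v = v + c + d) ∧
      ∀ v w, LayerStep d v w → h (φ v) (φ w) + h v w = 1 := by
  classical
  have hle : ∀ v, forwardDegree d h v ≤ 2 := fun v ↦ by
    have := hf.le_one v (v + 1); have := hf.le_one v (v + 1 + d)
    unfold forwardDegree; omega
  let U : A → Prop := fun v ↦ forwardDegree d h v = 1
  have hUd : ∀ v, U (v + d) ↔ ¬ U v := fun v ↦ by
    have := hodd v; have := hle v; have := hle (v + d)
    simp only [U]; omega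
  have hval : ∀ v w, LayerStep d v w → (h v w = 1 ↔
      (forwardDegree d h v + forwardDegree d h (v + d) = 1 ↔ U v ∧ U w)) := fun v w hs ↦ by
    have h₁ := hf.forwardDegree_eq hs
    have h₂ := hf.forwardDegree_eq (hf.step_add_left hs)
    have h₃ := hf.degree_eq hs
    have h₄ := hf.degree_eq (hf.step_add_right hs)
    have := hodd v
    have := hf.le_one v w
    have := hf.le_one (v + d) w
    have := hf.le_one v (w + d)
    have := hf.le_one (v + d) (w + d)
    simp only [U]
    omega
  let φ : A → A := fun v ↦ if (U v ↔ U (v + 1)) then v + 1 else v + 1 + d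
  have hφ : ∀ v, φ v = v + 1 ∨ φ v = v + 1 + d := fun v ↦ by
    simp only [φ]; split_ifs <;> simp
  have hφU : ∀ v, U (φ v) ↔ U v := fun v ↦ by
    by_cases hv : (U v ↔ U (v + 1))
    · simp only [φ, if_pos hv]; exact hv.symm
    · simp only [φ, if_neg hv, hUd]; tauto
  have hφd : ∀ v, φ (v + d) = φ v + d := fun v ↦ by
    have : (U (v + d) ↔ U (v + d + 1)) ↔ (U v ↔ U (v + 1)) := by
      rw [show v + d + 1 = v + 1 + d by ring, hUd, hUd]; tauto
    simp only [φ, this]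
    split_ifs <;> ring
  refine ⟨φ, 1, hφd, hφ, fun v w hs ↦ ?_⟩
  have hs' : LayerStep d (φ v) (φ w) := by
    have : LayerStep d (v + 1) (w + 1) := by
      rcases hs with rfl | rfl
      · left; rfl
      · right; ring
    rcases hφ v with e | e <;> rcases hφ w with e' | e' <;> rw [e, e']
    · exact this
    · exact hf.step_add_right this
    · exact hf.step_add_left this
    · exact hf.step_add_left (hf.step_add_right this)
  have hsum : forwardDegree d h (φ v) + forwardDegree d h (φ v + d) =
      forwardDegree d h (v + 1) + forwardDegree d h (v + 1 + d) := by
    rcases hφ v with e | e <;> rw [e]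
    rw [hf.add_cancel, add_comm]
  have h₁ := hval v w hs
  have h₂ := hval _ _ hs'
  rw [hφU, hφU, hsum] at h₂
  have := hf.layer_sum v
  have := hodd v
  have := hf.le_one v w
  have := hf.le_one (φ v) (φ w)
  by_cases hU : U v ∧ U w
  · simp only [hU, and_self, iff_true] at h₁ h₂
    omega
  · simp only [hU, iff_false] at h₁ h₂
    omega

end IsTwoFactor

/-- No proper nonempty set of vertices is closed under adjacency along `h`. -/
def LayerConnected (d : A) (h : A → A → ℕ) : Prop :=
  ∀ S : Set A, S.Nonempty → (∀ v w, LayerStep d v w → h v w = 1 → (v ∈ S ↔ w ∈ S)) → S = Set.univ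

variable {m : ℕ} {r : A →+* ZMod m}

lemma LayerStep.map_eq (hr : ∀ u v, r u = r v ↔ u = v ∨ u = v + d) {v w : A}
    (hs : LayerStep d v w) : r w = r v + 1 := by
  rw [← map_one r, ← map_add, hr]
  exact hs

lemma IsTwoFactor.forwardDegree_pos (hf : IsTwoFactor d h) {v w : A} (hs : LayerStep d v w)
    (hvw : h v w = 1) : 0 < forwardDegree d h v ∧ forwardDegree d h w < 2 := by
  have := hf.forwardDegree_eq hs
  have := hf.degree_eq hs
  omega

/-- In a connected 2-factor, two consecutive layers do not induce a cycle. -/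
lemma IsTwoFactor.layer_ne_four (hf : IsTwoFactor d h) (hc : LayerConnected d h)
    (hr : ∀ u v, r u = r v ↔ u = v ∨ u = v + d) (hm : 4 ≤ m) (v : A) :
    forwardDegree d h v + forwardDegree d h (v + d) ≠ 4 := by
  intro h4
  have hnext := hf.layer_sum v
  have hprev := hf.layer_sum (v - 1)
  rw [sub_add_cancel] at hprev
  have hzero : ∀ u, r u = r v + 1 ∨ r u + 1 = r v → forwardDegree d h u = 0 := by
    rintro u (hu | hu)
    · rw [← map_one r, ← map_add, hr] at hu
      rcases hu with rfl | rfl <;> omega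
    · rw [← eq_sub_iff_add_eq, ← map_one r, ← map_sub, hr] at hu
      rcases hu with rfl | rfl <;> omega
  have huniv := hc {u | r u = r v ∨ r u = r v + 1} ⟨v, Or.inl rfl⟩ fun a b hs hab ↦ by
    have hpos := hf.forwardDegree_pos hs hab
    have ha := hzero a
    simp only [Set.mem_ofPred_eq, hs.map_eq hr, add_left_inj]
    grind
  have hmem : v + 1 + 1 ∈ {u | r u = r v ∨ r u = r v + 1} := huniv ▸ Set.mem_univ _
  have h1 : ((1 : ℕ) : ZMod m) ≠ 0 := by
    rw [Ne, ZMod.natCast_eq_zero_iff]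
    exact fun hd ↦ by have := Nat.le_of_dvd one_pos hd; omega
  have h2 : ((2 : ℕ) : ZMod m) ≠ 0 := by
    rw [Ne, ZMod.natCast_eq_zero_iff]
    exact fun hd ↦ by have := Nat.le_of_dvd two_pos hd; omega
  simp only [Set.mem_ofPred_eq, map_add, map_one] at hmem
  rcases hmem with hmem | hmem
  · exact h2 (by push_cast; linear_combination hmem)
  · exact h1 (by push_cast; linear_combination hmem)

/-- In a connected 2-factor with two edges between any two consecutive layers, at most one layer
has a vertex with two edges forward. -/
lemma IsTwoFactor.layer_eq_of_forwardDegree_ne_one (hf : IsTwoFactor d h)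
    (hc : LayerConnected d h) (hr : ∀ u v, r u = r v ↔ u = v ∨ u = v + d) (hm : 4 ≤ m)
    (htwo : ∀ v, forwardDegree d h v + forwardDegree d h (v + d) = 2) {k : A}
    (hk : forwardDegree d h k = 2) {l : A} (hl : forwardDegree d h l ≠ 1) : r l = r k := by
  classical
  by_contra hlk
  have : NeZero m := ⟨by omega⟩
  have : Fact (1 < m) := ⟨by omega⟩
  let ρ : A → ℕ := fun v ↦ (r v - r k).val
  have hρlt : ∀ v, ρ v < m := fun v ↦ ZMod.val_lt _
  have hρ0 : ∀ v, ρ v = 0 ↔ v = k ∨ v = k + d := fun v ↦ by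
    rw [← hr, ← sub_eq_zero (a := r v), ← ZMod.val_eq_zero]
  have hρs : ∀ v w, LayerStep d v w → ρ w = (ρ v + 1) % m := fun v w hs ↦ by
    simp only [ρ]
    rw [hs.map_eq hr, add_sub_right_comm, ZMod.val_add, ZMod.val_one]
  have hkd := htwo k
  have hex : ∃ j, 0 < j ∧ ∃ v, ρ v = j ∧ forwardDegree d h v ≠ 1 :=
    ⟨ρ l, Nat.pos_of_ne_zero fun h0 ↦ hlk ((hr _ _).2 ((hρ0 l).1 h0)), l, rfl, hl⟩
  obtain ⟨hj, x, hxj, hx⟩ := Nat.find_spec hex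
  have hmin : ∀ v, 0 < ρ v → ρ v < Nat.find hex → forwardDegree d h v = 1 := fun v h0 hv ↦ by
    by_contra hne
    exact Nat.find_min hex hv ⟨h0, v, rfl, hne⟩
  generalize Nat.find hex = j at hj hxj hmin
  have hjm : j < m := hxj ▸ hρlt x
  have hjsplit : ∀ v, ρ v = j → forwardDegree d h v ≠ 1 := fun v hv ↦ by
    have hv' : r v = r x := by
      have : r v - r k = r x - r k := ZMod.val_injective m (hv.trans hxj.symm)
      simpa using this
    have := htwo x
    rcases (hr _ _).1 hv' with rfl | rfl <;> omega
  have hk1 : forwardDegree d h (k + 1) = 1 := by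
    have h₁ := hf.degree_eq (Or.inl rfl : LayerStep d k (k + 1))
    have h₂ := hf.degree_eq (Or.inr rfl : LayerStep d k (k + 1 + d))
    have := htwo (k + 1)
    have := hf.le_one k (k + 1)
    have := hf.le_one k (k + 1 + d)
    have : forwardDegree d h k = h k (k + 1) + h k (k + 1 + d) := rfl
    omega
  have hρk : ρ k = 0 := (hρ0 k).2 (Or.inl rfl)
  have hj1 : 1 < j := by
    have := hρs k (k + 1) (Or.inl rfl)
    rw [hρk, Nat.mod_eq_of_lt (by omega)] at this
    rcases Nat.lt_or_ge 1 j with hlt | hge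
    · exact hlt
    · exact absurd hk1 (hjsplit _ (by omega))
  have huniv := hc {v | v = k ∨ (0 < ρ v ∧ ρ v < j) ∨ (ρ v = j ∧ forwardDegree d h v = 0)}
    ⟨k, Or.inl rfl⟩ fun v w hs hvw ↦ by
      obtain ⟨hv, hw⟩ := hf.forwardDegree_pos hs hvw
      have hvw' := hρs v w hs
      have hlt := hρlt v
      have hv0 := hρ0 v
      have hw0 := hρ0 w
      have hvj := hjsplit v
      have hwj := hjsplit w
      have hwk : w ≠ k := by rintro rfl; omega
      have hvk : v ≠ k + d := by rintro rfl; omega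
      simp only [Set.mem_ofPred_eq]
      rcases Nat.lt_or_ge (ρ v + 1) m with hlt' | hge
      · rw [Nat.mod_eq_of_lt hlt'] at hvw'
        by_cases hvk' : v = k
        · have : ρ v = 0 := hv0.2 (Or.inl hvk')
          simp only [hvk', hwk, true_or, false_or, true_iff]
          omega
        · have : ρ v ≠ 0 := fun h0 ↦ by tauto
          simp only [hvk', hwk, false_or]
          omega
      · rw [show ρ v + 1 = m by omega, Nat.mod_self] at hvw'
        have : v ≠ k := by rintro rfl; omega
        simp only [this, hwk, false_or]
        omega
  have hmem : k + d ∈ {v | v = k ∨ (0 < ρ v ∧ ρ v < j) ∨ (ρ v = j ∧ forwardDegree d h v = 0)} :=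
    huniv ▸ Set.mem_univ _
  have hρkd : ρ (k + d) = 0 := (hρ0 _).2 (Or.inr rfl)
  rcases hmem with hmem | hmem | hmem
  · rw [hmem] at hkd; omega
  · omega
  · omega

/-- A connected 2-factor is mapped to its complement by an automorphism permuting the layers. -/
lemma IsTwoFactor.exists_complementing (hf : IsTwoFactor d h) (hc : LayerConnected d h)
    (hr : ∀ u v, r u = r v ↔ u = v ∨ u = v + d) (hm : 4 ≤ m) (hm2 : 2 ∣ m) :
    ∃ (φ : A → A) (c : A), (∀ v, φ (v + d) = φ v + d) ∧ (∀ v, φ v = v + c ∨ φ v = v + c + d) ∧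
      ∀ v w, LayerStep d v w → h (φ v) (φ w) + h v w = 1 := by
  classical
  have hsum : ∀ v, forwardDegree d h v + forwardDegree d h (v + d) =
      forwardDegree d h 0 + forwardDegree d h (0 + d) ∨
      forwardDegree d h v + forwardDegree d h (v + d) +
        (forwardDegree d h 0 + forwardDegree d h (0 + d)) = 4 := by
    have huniv := hc {v | forwardDegree d h v + forwardDegree d h (v + d) =
      forwardDegree d h 0 + forwardDegree d h (0 + d) ∨
      forwardDegree d h v + forwardDegree d h (v + d) +
        (forwardDegree d h 0 + forwardDegree d h (0 + d)) = 4} ⟨0, Or.inl rfl⟩ fun v w hs _ ↦ by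
      have h₁ := hf.layer_sum v
      have h₂ : forwardDegree d h w + forwardDegree d h (w + d) =
          forwardDegree d h (v + 1) + forwardDegree d h (v + 1 + d) := by
        rcases hs with rfl | rfl
        · rfl
        · rw [hf.add_cancel, add_comm]
      simp only [Set.mem_ofPred_eq]
      omega
    exact fun v ↦ (huniv ▸ Set.mem_univ v :)
  have hne : ∀ v, forwardDegree d h v + forwardDegree d h (v + d) ≠ 4 :=
    hf.layer_ne_four hc hr hm
  have h₀ := hf.layer_sum 0
  have hne₀ := hne 0
  have hne₁ := hne (0 + 1)
  by_cases htwo : forwardDegree d h 0 + forwardDegree d h (0 + d) = 2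
  · replace htwo : ∀ v, forwardDegree d h v + forwardDegree d h (v + d) = 2 := fun v ↦ by
      have := hsum v; omega
    obtain ⟨k, hk⟩ : ∃ k, ∀ l, forwardDegree d h l ≠ 1 → r l = r k := by
      by_cases hex : ∃ k, forwardDegree d h k = 2
      · obtain ⟨k, hk⟩ := hex
        exact ⟨k, fun l hl ↦ hf.layer_eq_of_forwardDegree_ne_one hc hr hm htwo hk hl⟩
      · push Not at hex
        refine ⟨0, fun l hl ↦ ?_⟩
        have := hex l; have := hex (l + d); have := htwo l
        omega
    let p : A →+* ZMod 2 := (ZMod.castHom hm2 (ZMod 2)).comp r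
    refine hf.exists_swap (fun v ↦ p v = p k) (fun v ↦ ?_) (fun v ↦ ?_) fun v hv ↦ ?_
    · rw [map_add, map_one]
      generalize p v = a
      generalize p k = b
      revert a b
      decide
    · have : r (v + d) = r v := (hr _ _).2 (Or.inr rfl)
      simp only [p, RingHom.comp_apply, this]
    · by_contra hne
      exact hv (by simp only [p, RingHom.comp_apply, hk v hne])
  · exact hf.exists_shift fun v ↦ by
      have := hsum v
      have := hne v
      omega

end Layers

section Circulant

open Walk

variable {n : ℕ}

lemma zmod_half_add_half (n : ℕ) :
    ((2 * n : ℕ) : ZMod (4 * n)) + ((2 * n : ℕ) : ZMod (4 * n)) = 0 := by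
  rw [← Nat.cast_add, show 2 * n + 2 * n = 4 * n by ring, ZMod.natCast_self]

lemma zmod_castHom_half_eq_iff (hn : 2 ≤ n) (u v : ZMod (4 * n)) :
    ZMod.castHom (⟨2, by ring⟩ : 2 * n ∣ 4 * n) (ZMod (2 * n)) u =
      ZMod.castHom (⟨2, by ring⟩ : 2 * n ∣ 4 * n) (ZMod (2 * n)) v ↔
      u = v ∨ u = v + ((2 * n : ℕ) : ZMod (4 * n)) := by
  have : NeZero (4 * n) := ⟨by omega⟩
  rw [← sub_eq_zero, ← map_sub]
  constructor
  · intro h0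
    obtain ⟨x, hx⟩ : ∃ x, u - v = x := ⟨_, rfl⟩
    rw [hx, ← ZMod.natCast_zmod_val x, map_natCast, ZMod.natCast_eq_zero_iff] at h0
    obtain ⟨q, hq⟩ := h0
    have hlt := ZMod.val_lt x
    have hq2 : q < 2 := by
      by_contra! hge
      have := Nat.mul_le_mul_left (2 * n) hge
      omega
    have hu : u = v + x := by rw [← hx]; ring
    rw [hu, ← ZMod.natCast_zmod_val x, hq]
    interval_cases q <;> simp
  · rintro (rfl | rfl)
    · simp
    · rw [add_sub_cancel_left, map_natCast, ZMod.natCast_self]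

lemma circulantGraph_adj_iff_layerStep (hn : 2 ≤ n) (v w : ZMod (4 * n)) :
    (circulantGraph
      ({((1 : ℕ) : ZMod (4 * n)), ((2 * n - 1 : ℕ) : ZMod (4 * n))} : Set (ZMod (4 * n)))).Adj v w ↔
      LayerStep ((2 * n : ℕ) : ZMod (4 * n)) v w ∨
        LayerStep ((2 * n : ℕ) : ZMod (4 * n)) w v := by
  have hdd := zmod_half_add_half n
  have hr := zmod_castHom_half_eq_iff hn
  have : Fact (1 < 2 * n) := ⟨by omega⟩
  have hne : ∀ a b, LayerStep ((2 * n : ℕ) : ZMod (4 * n)) a b → a ≠ b := by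
    rintro a b hs rfl
    have := hs.map_eq hr
    simp at this
  rw [circulantGraph_adj, Nat.cast_sub (by omega)]
  generalize ((2 * n : ℕ) : ZMod (4 * n)) = d at *
  have hstep : ∀ a b : ZMod (4 * n), LayerStep d a b ↔ b - a = 1 ∨ a - b = d - 1 := fun a b ↦ by
    unfold LayerStep
    constructor
    · rintro (rfl | rfl)
      · left; ring
      · right; linear_combination -hdd
    · rintro (hab | hab)
      · left; linear_combination hab
      · right; linear_combination -hab - hdd
  have h₁ := hne v w
  have h₂ := hne w v
  simp only [Set.mem_insert_iff, Set.mem_singleton_iff, Nat.cast_one, hstep] at *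
  grind

/-- The indicator function of the edges of a walk. -/
def edgeIndicator {V : Type*} [DecidableEq V] {G : SimpleGraph V} {x y : V} (H : G.Walk x y)
    (v w : V) : ℕ := if s(v, w) ∈ H.edges then 1 else 0

lemma edgeIndicator_eq_one_iff {V : Type*} [DecidableEq V] {G : SimpleGraph V} {x y : V}
    (H : G.Walk x y) (v w : V) : edgeIndicator H v w = 1 ↔ s(v, w) ∈ H.edges := by
  simp [edgeIndicator]

lemma SimpleGraph.Walk.mem_of_closed {V : Type*} {G : SimpleGraph V} {x y : V} (H : G.Walk x y)
    (S : Set V) (hS : ∀ v w, s(v, w) ∈ H.edges → (v ∈ S ↔ w ∈ S)) {u v : V} (hu : u ∈ H.support)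
    (huS : u ∈ S) (hv : v ∈ H.support) : v ∈ S := by
  suffices hx : ∀ w ∈ H.support, (x ∈ S ↔ w ∈ S) from (hx v hv).1 ((hx u hu).2 huS)
  clear hu hv
  induction H with
  | nil => simp
  | cons hadj p ih =>
    intro w hw
    rw [support_cons, List.mem_cons] at hw
    rcases hw with rfl | hw
    · rfl
    · rw [hS _ _ (List.mem_cons_self (a := s(_, _)))]
      exact ih (fun a b hab ↦ hS a b (by simp [hab])) w hw

variable {x : ZMod (4 * n)} {H : (circulantGraph
  ({((1 : ℕ) : ZMod (4 * n)), ((2 * n - 1 : ℕ) : ZMod (4 * n))} : Set (ZMod (4 * n)))).Walk x x}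

lemma layerConnected_edgeIndicator (hn : 2 ≤ n) (hH : H.IsHamiltonianCycle) :
    LayerConnected ((2 * n : ℕ) : ZMod (4 * n)) (edgeIndicator H) := by
  rintro S ⟨u, hu⟩ hS
  refine Set.eq_univ_of_forall fun v ↦
    H.mem_of_closed S (fun a b hab ↦ ?_) (hH.mem_support u) hu (hH.mem_support v)
  rcases (circulantGraph_adj_iff_layerStep hn a b).1 (H.adj_of_mem_edges hab) with hs | hs
  · exact hS a b hs ((edgeIndicator_eq_one_iff H a b).2 hab)
  · exact (hS b a hs ((edgeIndicator_eq_one_iff H b a).2 (Sym2.eq_swap ▸ hab))).symm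

lemma isTwoFactor_edgeIndicator (hn : 2 ≤ n) (hH : H.IsHamiltonianCycle) :
    IsTwoFactor ((2 * n : ℕ) : ZMod (4 * n)) (edgeIndicator H) where
  add_self := zmod_half_add_half n
  symm v w := by simp only [edgeIndicator, Sym2.eq_swap]
  le_one v w := by unfold edgeIndicator; split_ifs <;> simp
  degree v := by
    have hcard := hH.isCycle.ncard_neighborSet_toSubgraph_eq_two (hH.mem_support (v + 1))
    have hadj := circulantGraph_adj_iff_layerStep hn
    have hr := zmod_castHom_half_eq_iff hn
    have hdd := zmod_half_add_half n
    have hd : ((2 * n : ℕ) : ZMod (4 * n)) ≠ 0 := by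
      rw [Ne, ZMod.natCast_eq_zero_iff]
      exact fun hd ↦ by have := Nat.le_of_dvd (by omega) hd; omega
    generalize ((2 * n : ℕ) : ZMod (4 * n)) = d at *
    have h2 : ((2 : ℕ) : ZMod (2 * n)) ≠ 0 := by
      rw [Ne, ZMod.natCast_eq_zero_iff]
      exact fun hd ↦ by have := Nat.le_of_dvd two_pos hd; omega
    have hlayer : ∀ a b : ZMod (4 * n), (a = v ∨ a = v + d) →
        (b = v + 1 + 1 ∨ b = v + 1 + 1 + d) → b ≠ a := by
      rintro a b ha hb rfl
      rw [← hr] at ha hb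
      rw [ha] at hb
      refine h2 ?_
      simp only [map_add, map_one] at hb
      push_cast
      linear_combination -hb
    have hset : H.toSubgraph.neighborSet (v + 1) =
        (({v + 1 + 1, v + 1 + 1 + d, v, v + d} : Finset (ZMod (4 * n))).filter
          fun w ↦ s(v + 1, w) ∈ H.edges : Finset (ZMod (4 * n))) := by
      ext w
      simp only [Subgraph.mem_neighborSet, adj_toSubgraph_iff_mem_edges, Finset.coe_filter,
        Finset.mem_insert, Finset.mem_singleton, Set.mem_ofPred_eq]
      refine ⟨fun hw ↦ ⟨?_, hw⟩, fun hw ↦ hw.2⟩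
      rcases (hadj _ _).1 (H.adj_of_mem_edges hw) with (hs | hs) | (hs | hs)
      · exact Or.inl hs
      · exact Or.inr (Or.inl hs)
      · exact Or.inr (Or.inr (Or.inl (by linear_combination -hs)))
      · exact Or.inr (Or.inr (Or.inr (by linear_combination -hs - hdd)))
    rw [hset, Set.ncard_coe_finset, Finset.card_filter, Finset.sum_insert, Finset.sum_insert,
      Finset.sum_insert, Finset.sum_singleton] at hcard
    · simp only [forwardDegree, edgeIndicator]
      rw [Sym2.eq_swap (a := v), Sym2.eq_swap (a := v + d)]
      omega
    · simpa using hd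
    · simp [hlayer]
    · simp [hlayer, hd]

lemma circulantGraph_exists_isHamiltonianCycle (hn : 2 ≤ n) :
    ∃ (x : ZMod (4 * n)) (H : (circulantGraph
      ({((1 : ℕ) : ZMod (4 * n)), ((2 * n - 1 : ℕ) : ZMod (4 * n))} :
        Set (ZMod (4 * n)))).Walk x x), H.IsHamiltonianCycle := by
  have : NeZero (4 * n) := ⟨by omega⟩
  have hadj := circulantGraph_adj_iff_layerStep hn
  suffices hcont : cycleGraph (4 * n) ⊑ circulantGraph
      ({((1 : ℕ) : ZMod (4 * n)), ((2 * n - 1 : ℕ) : ZMod (4 * n))} : Set (ZMod (4 * n))) by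
    obtain ⟨x, H, hH, hlen⟩ := (cycleGraph_isContained_iff (by omega)).1 hcont
    exact ⟨x, H, isHamiltonianCycle_iff_isCycle_and_length_eq.2 ⟨hH, by rw [hlen, ZMod.card]⟩⟩
  have hsub : ∀ i j : Fin (4 * n), (i - j).val = 1 →
      ((i : ℕ) : ZMod (4 * n)) = ((j : ℕ) : ZMod (4 * n)) + 1 := fun i j hij ↦ by
    have hcast := congrArg (Nat.cast : ℕ → ZMod (4 * n)) hij
    rw [Fin.val_sub, ZMod.natCast_mod, Nat.cast_add, Nat.cast_sub j.2.le, ZMod.natCast_self,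
      Nat.cast_one] at hcast
    linear_combination hcast
  refine ⟨⟨⟨fun i ↦ ((i : ℕ) : ZMod (4 * n)), fun {i j} hij ↦ ?_⟩, fun i j hij ↦ ?_⟩⟩
  · rw [hadj]
    rcases cycleGraph_adj'.1 hij with hij | hij
    · exact Or.inr (Or.inl (hsub _ _ hij))
    · exact Or.inl (Or.inl (hsub _ _ hij))
  · replace hij : ((i : ℕ) : ZMod (4 * n)) = ((j : ℕ) : ZMod (4 * n)) := hij
    have hval := congrArg ZMod.val hij
    rw [ZMod.val_cast_of_lt i.2, ZMod.val_cast_of_lt j.2] at hval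
    exact Fin.ext hval

end Circulant

/-- For every `n ≥ 2`, the circulant graph `C_{4n}^{1, 2n-1}` on `ℤ/4n`, with `i ~ j` iff
`i - j ≡ ±1` or `±(2n-1) (mod 4n)`, is Hamiltonian-paired. -/
theorem circulant_hamiltonianPaired (n : ℕ) (hn : 2 ≤ n) :
    HamiltonianPaired (SimpleGraph.circulantGraph
      ({((1 : ℕ) : ZMod (4 * n)), ((2 * n - 1 : ℕ) : ZMod (4 * n))} : Set (ZMod (4 * n)))) := by
  have : NeZero (4 * n) := ⟨by omega⟩
  refine ⟨circulantGraph_exists_isHamiltonianCycle hn, fun x H hH ↦ ?_⟩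
  have hf := isTwoFactor_edgeIndicator hn hH
  have hr := zmod_castHom_half_eq_iff hn
  have hadj := circulantGraph_adj_iff_layerStep hn
  obtain ⟨φ, c, hφd, hφc, hφ⟩ := hf.exists_complementing (layerConnected_edgeIndicator hn hH) hr
    (by omega) ⟨n, rfl⟩
  have hinj : Function.Injective φ := fun u v huv ↦ by
    have huv' : u = v ∨ u = v + ((2 * n : ℕ) : ZMod (4 * n)) := by
      have hdd := hf.add_self
      rcases hφc u with hu | hu <;> rcases hφc v with hv | hv <;> rw [hu, hv] at huv
      · left; linear_combination huv
      · right; linear_combination huv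
      · right; linear_combination huv - hdd
      · left; linear_combination huv
    rcases huv' with rfl | rfl
    · rfl
    · rwa [hφd, add_eq_left, ← add_eq_left (a := v)] at huv
  have hstep : ∀ u v, LayerStep ((2 * n : ℕ) : ZMod (4 * n)) (φ u) (φ v) ↔
      LayerStep ((2 * n : ℕ) : ZMod (4 * n)) u v := fun u v ↦ by
    have hs : LayerStep ((2 * n : ℕ) : ZMod (4 * n)) (u + c) (v + c) ↔
        LayerStep ((2 * n : ℕ) : ZMod (4 * n)) u v := by
      simp only [LayerStep, add_right_comm _ c, add_left_inj]
    rcases hφc u with hu | hu <;> rcases hφc v with hv | hv <;>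
      simp only [hu, hv, hf.step_add_left_iff, hf.step_add_right_iff, hs]
  have hbij : Function.Bijective φ := Finite.injective_iff_bijective.1 hinj
  let Φ : circulantGraph
      ({((1 : ℕ) : ZMod (4 * n)), ((2 * n - 1 : ℕ) : ZMod (4 * n))} : Set (ZMod (4 * n))) →g
      circulantGraph
      ({((1 : ℕ) : ZMod (4 * n)), ((2 * n - 1 : ℕ) : ZMod (4 * n))} : Set (ZMod (4 * n))) :=
    ⟨φ, fun {u v} huv ↦ by
      rw [hadj] at huv ⊢
      exact huv.imp (hstep _ _).2 (hstep _ _).2⟩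
  refine ⟨Φ x, H.map Φ, hH.map hbij, fun e ↦ ?_⟩
  have hflip : ∀ u v, LayerStep ((2 * n : ℕ) : ZMod (4 * n)) u v →
      (s(u, v) ∈ H.edges ↔ s(φ u, φ v) ∉ H.edges) := fun u v hs ↦ by
    have hsum := hφ u v hs
    rw [← edgeIndicator_eq_one_iff, ← edgeIndicator_eq_one_iff]
    omega
  induction e with | _ a b
  obtain ⟨u, rfl⟩ := hbij.2 a
  obtain ⟨v, rfl⟩ := hbij.2 b
  have hmem : s(φ u, φ v) ∈ (H.map Φ).edges ↔ s(u, v) ∈ H.edges := by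
    rw [Walk.edges_map, show s(φ u, φ v) = Sym2.map Φ s(u, v) from rfl]
    exact List.mem_map_of_injective (Sym2.map.injective hinj)
  rw [hmem, mem_edgeSet, hadj, hstep, hstep, ← hadj]
  refine ⟨fun huv ↦ ⟨H.adj_of_mem_edges huv, ?_⟩, fun ⟨huv, hnot⟩ ↦ ?_⟩
  · rcases (hadj u v).1 (H.adj_of_mem_edges huv) with hs | hs
    · exact (hflip u v hs).1 huv
    · rw [Sym2.eq_swap] at huv ⊢
      exact (hflip v u hs).1 huv
  · rcases (hadj u v).1 huv with hs | hs
    · exact (hflip u v hs).2 hnot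
    · rw [Sym2.eq_swap] at hnot ⊢
      exact (hflip v u hs).2 hnot
end
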